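/- arXiv:math/0101003 — 4 statements merged into one kernel-verified Lean document; each statement's English description precedes it below -/
import Mathlib

section
/- Let ℏ be a nonzero real number and let t > 0. Define ψ_t : ℂ → ℂ by ψ_t(z) = exp(i z² / (2ℏ)) · exp(i z (log t) / ℏ). Then for every z ∈ ℂ one has e^{iℏ/2} · e^{−z} · ψ_t(z − iℏ) = t · ψ_t(z). -/
/-- For `ℏ ≠ 0`, `t > 0` and `ψ_t(z) = exp(i z²/(2ℏ)) · exp(i z log t / ℏ)`,
one has `e^{iℏ/2} · e^{−z} · ψ_t(z − iℏ) = t · ψ_t(z)` for all `z ∈ ℂ`. -/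
theorem stmt1 (ℏ : ℝ) (hℏ : ℏ ≠ 0) (t : ℝ) (ht : 0 < t) (ψ : ℂ → ℂ)
    (hψ : ∀ z : ℂ, ψ z =
      Complex.exp (Complex.I * z ^ 2 / (2 * (ℏ : ℂ))) *
        Complex.exp (Complex.I * z * (Real.log t : ℂ) / (ℏ : ℂ))) :
    ∀ z : ℂ,
      Complex.exp (Complex.I * (ℏ : ℂ) / 2) * Complex.exp (-z) * ψ (z - Complex.I * (ℏ : ℂ)) =
        (t : ℂ) * ψ z := by
  intro z
  have hc : (ℏ : ℂ) ≠ 0 := Complex.ofReal_ne_zero.mpr hℏ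
  have hlog : (t : ℂ) = Complex.exp (Real.log t : ℂ) := by
    rw [← Complex.ofReal_exp, Real.exp_log ht]
  rw [hψ, hψ, hlog]
  simp only [← Complex.exp_add]
  congr 1
  field_simp
  linear_combination (-2 * z * (ℏ : ℂ) - 2 * (Real.log t : ℂ) * (ℏ : ℂ) +
    Complex.I * (ℏ : ℂ) ^ 2) * Complex.I_sq
end

section
/- Let θ > 1 be a real number and let x ∈ ℂ with |Im x| < π. Then the function a ↦ log(1 + a^{−θ}) / (a + e^{−x}) is integrable on the interval (0, ∞). In particular its denominator a + e^{−x} is nonzero for every a > 0. -/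
open MeasureTheory

/-- A point of the slit plane stays at positive distance from the negative real axis. -/
lemma exists_pos_le_norm_ofReal_add {c : ℂ} (hc : c ∈ Complex.slitPlane) :
    ∃ δ : ℝ, 0 < δ ∧ ∀ a : ℝ, 0 < a → δ ≤ ‖(a : ℂ) + c‖ := by
  rcases Complex.mem_slitPlane_iff.1 hc with h | h
  · refine ⟨c.re, h, fun a ha => ?_⟩
    have := Complex.re_le_norm ((a : ℂ) + c)
    simp only [Complex.add_re, Complex.ofReal_re] at this
    linarith
  · refine ⟨|c.im|, abs_pos.2 h, fun a _ => ?_⟩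
    simpa using Complex.abs_im_le_norm ((a : ℂ) + c)

lemma exp_mem_slitPlane_of_abs_im_lt_pi {z : ℂ} (hz : |z.im| < Real.pi) :
    Complex.exp z ∈ Complex.slitPlane := by
  obtain ⟨h₁, h₂⟩ := abs_lt.1 hz
  rw [Complex.mem_slitPlane_iff_arg, Complex.arg_exp,
    (toIocMod_eq_self Real.two_pi_pos).2 ⟨h₁, by linarith⟩]
  exact ⟨h₂.ne, Complex.exp_ne_zero z⟩

lemma integrableOn_log_one_add_rpow_neg {θ : ℝ} (hθ : 1 < θ) :
    IntegrableOn (fun a : ℝ => Real.log (1 + a ^ (-θ))) (Set.Ioi 0) := by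
  have hmeas : Measurable fun a : ℝ => Real.log (1 + a ^ (-θ)) := by fun_prop
  have hnonneg : ∀ a : ℝ, 0 < a → 0 ≤ Real.log (1 + a ^ (-θ)) := fun a ha =>
    Real.log_nonneg (by linarith [Real.rpow_pos_of_pos ha (-θ)])
  rw [← Set.Ioc_union_Ioi_eq_Ioi zero_le_one]
  refine IntegrableOn.union ?_ ?_
  · have hbound : IntegrableOn (fun a : ℝ => Real.log 2 - θ * Real.log a) (Set.Ioc 0 1) := by
      rw [← intervalIntegrable_iff_integrableOn_Ioc_of_le zero_le_one]
      exact intervalIntegrable_const.sub (intervalIntegral.intervalIntegrable_log'.const_mul θ)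
    refine Integrable.mono' hbound hmeas.aestronglyMeasurable ?_
    filter_upwards [ae_restrict_mem measurableSet_Ioc] with a ha
    have hpos := Real.rpow_pos_of_pos ha.1 (-θ)
    have hone : 1 ≤ a ^ (-θ) :=
      Real.one_le_rpow_of_pos_of_le_one_of_nonpos ha.1 ha.2 (by linarith)
    rw [Real.norm_of_nonneg (hnonneg a ha.1)]
    calc Real.log (1 + a ^ (-θ)) ≤ Real.log (2 * a ^ (-θ)) :=
          Real.log_le_log (by linarith) (by linarith)
      _ = Real.log 2 - θ * Real.log a := by
          rw [Real.log_mul two_ne_zero hpos.ne', Real.log_rpow ha.1]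
          ring
  · refine Integrable.mono' (integrableOn_Ioi_rpow_of_lt (by linarith : -θ < -1) one_pos)
      hmeas.aestronglyMeasurable ?_
    filter_upwards [ae_restrict_mem measurableSet_Ioi] with a ha
    have ha0 : 0 < a := one_pos.trans ha
    rw [Real.norm_of_nonneg (hnonneg a ha0)]
    linarith [Real.log_le_sub_one_of_pos
      (by linarith [Real.rpow_pos_of_pos ha0 (-θ)] : 0 < 1 + a ^ (-θ))]

/-- For `θ > 1` and `x ∈ ℂ` with `|Im x| < π`, the function
`a ↦ log(1 + a^{−θ}) / (a + e^{−x})` is integrable on `(0, ∞)`, and its denominator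
is nonzero for every `a > 0`. -/
theorem stmt2 (θ : ℝ) (hθ : 1 < θ) (x : ℂ) (hx : |x.im| < Real.pi) :
    IntegrableOn
      (fun a : ℝ => (Real.log (1 + a ^ (-θ)) : ℂ) / ((a : ℂ) + Complex.exp (-x)))
      (Set.Ioi 0) volume ∧
    ∀ a : ℝ, 0 < a → (a : ℂ) + Complex.exp (-x) ≠ 0 := by
  obtain ⟨δ, hδ, hle⟩ := exists_pos_le_norm_ofReal_add
    (exp_mem_slitPlane_of_abs_im_lt_pi (z := -x) (by simpa using hx))
  refine ⟨?_, fun a ha => norm_pos_iff.1 (hδ.trans_le (hle a ha))⟩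
  have hmeas : Measurable fun a : ℝ =>
      (Real.log (1 + a ^ (-θ)) : ℂ) / ((a : ℂ) + Complex.exp (-x)) := by fun_prop
  refine Integrable.mono' ((integrableOn_log_one_add_rpow_neg hθ).norm.div_const δ)
    hmeas.aestronglyMeasurable ?_
  filter_upwards [ae_restrict_mem measurableSet_Ioi] with a ha
  rw [norm_div, Complex.norm_real]
  exact div_le_div_of_nonneg_left (norm_nonneg _) hδ (hle a ha)
end

section
/- Let θ > 1 be a real number. Then ∫₀^∞ log(1 + a^{−θ}) / (a + e^{−x}) da tends to 0 as the real variable x tends to −∞; consequently Vθ(x) → 1 as x → −∞ along the reals. -/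
open MeasureTheory

/-- If `f` is integrable on `(0, ∞)`, then its Stieltjes transform `∫ f(a) / (a + e^{-x}) da`
tends to `0` as `x → -∞`. -/
lemma tendsto_integral_div_add_exp_neg_atBot {f : ℝ → ℝ} (hf : IntegrableOn f (Set.Ioi 0)) :
    Filter.Tendsto
      (fun x : ℝ => ∫ a in Set.Ioi (0 : ℝ), (f a : ℂ) / ((a : ℂ) + Complex.exp (-(x : ℂ))))
      Filter.atBot (nhds 0) := by
  have hbound : Filter.Tendsto (fun x : ℝ => ∫ a in Set.Ioi (0 : ℝ), ‖f a‖ * Real.exp x)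
      Filter.atBot (nhds 0) := by
    simp_rw [integral_mul_const]
    simpa using Real.tendsto_exp_atBot.const_mul (∫ a in Set.Ioi (0 : ℝ), ‖f a‖)
  refine squeeze_zero_norm (fun x => ?_) hbound
  refine norm_integral_le_of_norm_le (hf.norm.mul_const _) ?_
  filter_upwards [ae_restrict_mem measurableSet_Ioi] with a ha
  have ha0 : 0 < a := ha
  have hexp := Real.exp_pos (-x)
  have hden : (a : ℂ) + Complex.exp (-(x : ℂ)) = ((a + Real.exp (-x) : ℝ) : ℂ) := by
    push_cast; rfl
  rw [hden, norm_div, Complex.norm_real, Complex.norm_real,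
    Real.norm_of_nonneg (add_pos ha0 hexp).le, ← neg_neg x, Real.exp_neg (-x), neg_neg,
    ← div_eq_mul_inv]
  gcongr
  linarith

/-- For `θ > 1`, `∫₀^∞ log(1 + a^{−θ})/(a + e^{−x}) da → 0` as the real
variable `x → −∞`; consequently `Vθ(x) → 1` as `x → −∞` along the reals. -/
theorem stmt5 (θ : ℝ) (hθ : 1 < θ) :
    Filter.Tendsto
      (fun x : ℝ =>
        ∫ a in Set.Ioi (0 : ℝ),
          (Real.log (1 + a ^ (-θ)) : ℂ) / ((a : ℂ) + Complex.exp (-(x : ℂ))))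
      Filter.atBot (nhds 0) ∧
    Filter.Tendsto
      (fun x : ℝ =>
        Complex.exp ((1 / (2 * (Real.pi : ℂ) * Complex.I)) *
          ∫ a in Set.Ioi (0 : ℝ),
            (Real.log (1 + a ^ (-θ)) : ℂ) / ((a : ℂ) + Complex.exp (-(x : ℂ)))))
      Filter.atBot (nhds 1) := by
  have h := tendsto_integral_div_add_exp_neg_atBot (integrableOn_log_one_add_rpow_neg hθ)
  refine ⟨h, ?_⟩
  simpa using (h.const_mul (1 / (2 * (Real.pi : ℂ) * Complex.I))).cexp
end

section
/- Let θ > 1 be a real number. Then the function g : ℝ → ℝ defined by g(x) = ∫₀^∞ log(1 + a^{−θ}) / (a + e^{−x}) da is real-valued and strictly increasing on ℝ. -/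
open MeasureTheory

lemma measurable_log_one_add_rpow_neg (θ : ℝ) :
    Measurable fun a : ℝ => Real.log (1 + a ^ (-θ)) := by
  fun_prop

lemma log_one_add_rpow_neg_pos (θ : ℝ) {a : ℝ} (ha : 0 < a) : 0 < Real.log (1 + a ^ (-θ)) :=
  Real.log_pos (by linarith [Real.rpow_pos_of_pos ha (-θ)])

lemma integrableOn_log_one_add_rpow_neg_div {θ c : ℝ} (hθ : 1 < θ) (hc : 0 < c) :
    IntegrableOn (fun a : ℝ => Real.log (1 + a ^ (-θ)) / (a + c)) (Set.Ioi 0) := by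
  refine Integrable.mono' ((integrableOn_log_one_add_rpow_neg hθ).div_const c)
    ((measurable_log_one_add_rpow_neg θ).div (measurable_id.add_const c)).aestronglyMeasurable ?_
  refine (ae_restrict_iff' measurableSet_Ioi).2 (.of_forall fun a (ha : 0 < a) => ?_)
  have hlog := log_one_add_rpow_neg_pos θ ha
  rw [Real.norm_of_nonneg (by positivity)]
  gcongr
  linarith

/-- For `θ > 1`, the function
`g(x) = ∫₀^∞ log(1 + a^{−θ}) / (a + e^{−x}) da` is real-valued (the complex integral
equals the corresponding real integral) and strictly increasing on `ℝ`. -/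
theorem stmt7 (θ : ℝ) (hθ : 1 < θ) :
    (∀ x : ℝ,
      (∫ a in Set.Ioi (0 : ℝ),
          (Real.log (1 + a ^ (-θ)) : ℂ) / ((a : ℂ) + Complex.exp (-(x : ℂ)))) =
        ((∫ a in Set.Ioi (0 : ℝ), Real.log (1 + a ^ (-θ)) / (a + Real.exp (-x))) : ℂ)) ∧
    StrictMono
      (fun x : ℝ => ∫ a in Set.Ioi (0 : ℝ), Real.log (1 + a ^ (-θ)) / (a + Real.exp (-x))) := by
  refine ⟨fun x => by push_cast; rfl, fun x y hxy => ?_⟩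
  have hx := integrableOn_log_one_add_rpow_neg_div hθ (Real.exp_pos (-x))
  have hy := integrableOn_log_one_add_rpow_neg_div hθ (Real.exp_pos (-y))
  have hpos : ∀ a ∈ Set.Ioi (0 : ℝ), 0 < Real.log (1 + a ^ (-θ)) / (a + Real.exp (-y)) -
      Real.log (1 + a ^ (-θ)) / (a + Real.exp (-x)) := by
    intro a (ha : 0 < a)
    have hlog := log_one_add_rpow_neg_pos θ ha
    rw [sub_pos]
    gcongr
  rw [← sub_pos, ← integral_sub hy hx, setIntegral_pos_iff_support_of_nonneg_ae
    ((ae_restrict_iff' measurableSet_Ioi).2 (.of_forall fun a ha => (hpos a ha).le)) (hy.sub hx),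
    Set.inter_eq_right.2 fun a ha => Function.mem_support.2 (hpos a ha).ne']
  simp
end
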